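/- Let S and T be commutative adequate partial semigroups, let h : S → T be a surjective partial semigroup homomorphism, and let A ⊆ T. Suppose there exists q ∈ J_δ(S) such that the pushforward p = h̃(q) is an idempotent ultrafilter in δT with A ∈ p. Then h⁻¹(A) is a C-set in S. -/

import Mathlib

universe u v

/-- A partial semigroup: a partially defined operation (modelled as an
`Option`-valued operation) which is associative in the strong sense that
`(x ∗ y) ∗ z = x ∗ (y ∗ z)`, where either side is defined iff the other is. -/
structure PartialSemigroup (S : Type u) : Type u where
  op : S → S → Option S
  assoc : ∀ x y z : S,
    (op x y).bind (fun w => op w z) = (op y z).bind (fun w => op x w)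

namespace PartialSemigroup

variable {S : Type u} {T : Type v}

/-- `φ(s) = {t : s ∗ t is defined}`. -/
def phi (P : PartialSemigroup S) (s : S) : Set S :=
  {t | (P.op s t).isSome}

/-- `σ(H) = ⋂_{s ∈ H} φ(s)`. -/
def sigma (P : PartialSemigroup S) (W : Finset S) : Set S :=
  {t | ∀ s ∈ W, t ∈ P.phi s}

/-- `S` is adequate iff `σ(H) ≠ ∅` for every finite nonempty `H ⊆ S`. -/
def Adequate (P : PartialSemigroup S) : Prop :=
  ∀ W : Finset S, W.Nonempty → (P.sigma W).Nonempty

/-- Commutativity: `x ∗ y = y ∗ x` (either both undefined, or both defined and equal). -/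
def Comm (P : PartialSemigroup S) : Prop :=
  ∀ x y : S, P.op x y = P.op y x

/-- The (partial) product of a list of elements, taken in order. -/
def listProd (P : PartialSemigroup S) : List S → Option S
  | [] => none
  | [x] => some x
  | x :: y :: l => (P.listProd (y :: l)).bind (fun w => P.op x w)

/-- The (partial) product of a list of partially defined elements, taken in order. -/
def optListProd (P : PartialSemigroup S) : List (Option S) → Option S
  | [] => none
  | [x] => x
  | x :: y :: l => (P.optListProd (y :: l)).bind (fun w => x.bind (fun a => P.op a w))

/-- `∏_{n ∈ F} f n`, the product in increasing order of indices. -/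
def finProd (P : PartialSemigroup S) (f : ℕ → S) (F : Finset ℕ) : Option S :=
  P.listProd ((F.sort (· ≤ ·)).map f)

/-- `FP(⟨f n⟩_{n=m}^∞)`: all finite products with indices at least `m`. -/
def FP (P : PartialSemigroup S) (f : ℕ → S) (m : ℕ) : Set S :=
  {x | ∃ F : Finset ℕ, F.Nonempty ∧ (∀ n ∈ F, m ≤ n) ∧ P.finProd f F = some x}

/-- An adequate sequence. -/
def AdequateSeq (P : PartialSemigroup S) (f : ℕ → S) : Prop :=
  (∀ F : Finset ℕ, F.Nonempty → (P.finProd f F).isSome) ∧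
  (∀ K : Finset S, K.Nonempty → ∃ m : ℕ, P.FP f m ⊆ P.sigma K)

/-- `σ(W ∗ a)`, where `W ∗ a = {w ∗ a : w ∈ W}`. -/
def sigmaMulRight (P : PartialSemigroup S) (W : Finset S) (a : S) : Set S :=
  {t | ∀ w ∈ W, ∀ y : S, P.op w a = some y → t ∈ P.phi y}

/-- `x⁻¹A = {t ∈ φ(x) : x ∗ t ∈ A}`. -/
def inv (P : PartialSemigroup S) (x : S) (A : Set S) : Set S :=
  {t | ∃ z : S, P.op x t = some z ∧ z ∈ A}

/-- A `J_δ`-set. -/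
def JSet (P : PartialSemigroup S) (A : Set S) : Prop :=
  ∀ F : Finset {f : ℕ → S // P.AdequateSeq f}, F.Nonempty →
    ∀ W : Finset S, W.Nonempty →
      ∃ a ∈ P.sigma W, ∃ H : Finset ℕ, H.Nonempty ∧
        ∀ f ∈ F, ∃ x : S, P.finProd f.1 H = some x ∧
          x ∈ P.sigmaMulRight W a ∧
          ∃ z : S, P.op a x = some z ∧ z ∈ A

/-- `δS`: the ultrafilters containing every `φ(s)`. -/
def delta (P : PartialSemigroup S) : Set (Ultrafilter S) :=
  {p | ∀ s : S, P.phi s ∈ p}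

/-- `J_δ(S) = {p ∈ δS : every member of p is a J_δ-set}`. -/
def Jdelta (P : PartialSemigroup S) : Set (Ultrafilter S) :=
  {p | p ∈ P.delta ∧ ∀ A : Set S, A ∈ p → P.JSet A}

/-- `p` is idempotent: `A ∈ p ↔ {x : x⁻¹A ∈ p} ∈ p` for all `A`. -/
def IsIdempotent (P : PartialSemigroup S) (p : Ultrafilter S) : Prop :=
  ∀ A : Set S, A ∈ p ↔ {x : S | P.inv x A ∈ p} ∈ p

/-- `B_f(T) = {x : f⌢x ∈ T}`, where functions with domain `{0,…,n−1}`
are modelled as lists of length `n` and `f⌢x` is `f ++ [x]`. -/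
def Bf (T : Set (List S)) (f : List S) : Set S :=
  {x | f ++ [x] ∈ T}

/-- A `C`-set. -/
def CSet (P : PartialSemigroup S) (A : Set S) : Prop :=
  ∃ (α : Finset {f : ℕ → S // P.AdequateSeq f} → S)
    (H : Finset {f : ℕ → S // P.AdequateSeq f} → Finset ℕ),
    (∀ F : Finset {f : ℕ → S // P.AdequateSeq f}, F.Nonempty → (H F).Nonempty) ∧
    (∀ F G : Finset {f : ℕ → S // P.AdequateSeq f}, F.Nonempty → F ⊂ G →
        ∀ i ∈ H F, ∀ j ∈ H G, i < j) ∧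
    (∀ m : ℕ, ∀ G : Fin (m + 1) → Finset {f : ℕ → S // P.AdequateSeq f},
        (∀ i j : Fin (m + 1), i < j → G i ⊂ G j) → (G 0).Nonempty →
        ∀ f : Fin (m + 1) → {f : ℕ → S // P.AdequateSeq f}, (∀ i, f i ∈ G i) →
          ∃ z : S,
            P.optListProd (List.ofFn (fun i =>
              (P.finProd (f i).1 (H (G i))).bind (fun x => P.op (α (G i)) x))) = some z ∧
            z ∈ A)

/-- A partial semigroup homomorphism. -/
def IsPSHom (P : PartialSemigroup S) (Q : PartialSemigroup T) (h : S → T) : Prop :=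
  ∀ x y z : S, P.op x y = some z → Q.op (h x) (h y) = some (h z)

end PartialSemigroup

namespace PartialSemigroup

variable {S : Type u} {T : Type v}

theorem finProd_map_add (P : PartialSemigroup S) (f : ℕ → S) (N : ℕ) (F : Finset ℕ) :
    P.finProd f (F.map (addRightEmbedding N)) = P.finProd (fun n => f (n + N)) F := by
  have hsort : (F.map (addRightEmbedding N)).sort (· ≤ ·) =
      (F.sort (· ≤ ·)).map (· + N) := by
    refine List.Perm.eq_of_pairwise' (Finset.pairwise_sort _ _) ?_ ?_
    · exact List.Pairwise.map _ (fun a b hab => Nat.add_le_add_right hab N)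
        (Finset.pairwise_sort F (· ≤ ·))
    · refine (List.perm_ext_iff_of_nodup (Finset.sort_nodup _ _)
        ((Finset.sort_nodup _ _).map (add_left_injective N))).2 fun x => ?_
      simp
  simp only [finProd, hsort, List.map_map, Function.comp_def]

/-- A tail of an adequate sequence is an adequate sequence. -/
theorem AdequateSeq.shift {P : PartialSemigroup S} {f : ℕ → S} (hf : P.AdequateSeq f) (N : ℕ) :
    P.AdequateSeq (fun n => f (n + N)) := by
  refine ⟨fun F hF => ?_, fun K hK => ?_⟩
  · rw [← finProd_map_add]
    exact hf.1 _ (hF.map)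
  · obtain ⟨m, hm⟩ := hf.2 K hK
    refine ⟨m, fun x hx => hm ?_⟩
    obtain ⟨F, hF, hmF, hx⟩ := hx
    refine ⟨F.map (addRightEmbedding N), hF.map, ?_, by rw [finProd_map_add, hx]⟩
    intro n hn
    obtain ⟨k, hk, rfl⟩ := Finset.mem_map.1 hn
    exact (hmF k hk).trans (Nat.le_add_right k N)

/-- The index set witnessing that `A` is a `J_δ`-set may be taken beyond any given bound. -/
theorem JSet.exists_beyond {P : PartialSemigroup S} {A : Set S} (hA : P.JSet A) (N : ℕ)
    (F : Finset {f : ℕ → S // P.AdequateSeq f}) (hF : F.Nonempty)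
    (W : Finset S) (hW : W.Nonempty) :
    ∃ a ∈ P.sigma W, ∃ H : Finset ℕ, H.Nonempty ∧ (∀ n ∈ H, N ≤ n) ∧
      ∀ f ∈ F, ∃ x : S, P.finProd f.1 H = some x ∧ x ∈ P.sigmaMulRight W a ∧
        ∃ z : S, P.op a x = some z ∧ z ∈ A := by
  classical
  let shift (f : {f : ℕ → S // P.AdequateSeq f}) : {f : ℕ → S // P.AdequateSeq f} :=
    ⟨fun n => f.1 (n + N), f.2.shift N⟩
  obtain ⟨a, ha, H, hH, hF'⟩ := hA (F.image shift) (hF.image _) W hW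
  refine ⟨a, ha, H.map (addRightEmbedding N), hH.map, ?_, fun f hf => ?_⟩
  · intro n hn
    obtain ⟨k, -, rfl⟩ := Finset.mem_map.1 hn
    exact Nat.le_add_left N k
  · rw [finProd_map_add]
    exact hF' _ (Finset.mem_image_of_mem shift hf)

/-- If `w ∗ a` and `(w ∗ a) ∗ x` are defined and `a ∗ x = z`, then `w ∗ z` is defined. -/
theorem exists_op_of_mem_sigma {P : PartialSemigroup S} {W : Finset S} {a x z w : S}
    (ha : a ∈ P.sigma W) (hx : x ∈ P.sigmaMulRight W a) (hz : P.op a x = some z) (hw : w ∈ W) :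
    ∃ y, P.op w z = some y := by
  obtain ⟨u, hu⟩ := Option.isSome_iff_exists.1 (ha w hw)
  obtain ⟨y, hy⟩ := Option.isSome_iff_exists.1 (hx w hw u hu)
  have hassoc := P.assoc w a x
  rw [hu, hz] at hassoc
  exact ⟨y, hassoc.symm.trans hy⟩

theorem optListProd_append_singleton (P : PartialSemigroup S) (l : List (Option S)) {w z : S}
    (hl : P.optListProd l = some w) : P.optListProd (l ++ [some z]) = P.op w z := by
  induction l generalizing w with
  | nil => simp [optListProd] at hl
  | cons x l ih =>
    cases l with
    | nil =>
      simp only [optListProd] at hl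
      simp [optListProd, hl]
    | cons y l =>
      simp only [optListProd, Option.bind_eq_some_iff] at hl
      obtain ⟨v, hv, a, rfl, hw⟩ := hl
      have hassoc := P.assoc a v z
      rw [hw] at hassoc
      have hrec := ih hv
      simp only [List.cons_append] at hrec
      simp only [List.cons_append, optListProd, hrec, Option.bind_some]
      exact hassoc.symm

/-- `A* = {x ∈ A : x⁻¹A ∈ p}`. -/
def star (P : PartialSemigroup S) (p : Ultrafilter S) (A : Set S) : Set S :=
  A ∩ {x | P.inv x A ∈ p}

theorem IsIdempotent.star_mem {P : PartialSemigroup S} {p : Ultrafilter S}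
    (hp : P.IsIdempotent p) {A : Set S} (hA : A ∈ p) : P.star p A ∈ p :=
  Filter.inter_mem hA ((hp A).1 hA)

theorem IsIdempotent.inv_star_mem {P : PartialSemigroup S} {p : Ultrafilter S}
    (hp : P.IsIdempotent p) {A : Set S} {x : S} (hx : x ∈ P.star p A) :
    P.inv x (P.star p A) ∈ p := by
  filter_upwards [hx.2, (hp _).1 hx.2] with y hy hy'
  obtain ⟨z, hz, hzA⟩ := hy
  refine ⟨z, hz, hzA, ?_⟩
  filter_upwards [show P.inv y (P.inv x A) ∈ p from hy'] with t ht
  obtain ⟨w, hw, v, hv, hvA⟩ := ht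
  have hassoc := P.assoc x y t
  rw [hz, hw] at hassoc
  exact ⟨v, hassoc.trans hv, hvA⟩

/-- Well-founded recursion with a choice at each step subject to a relation with the values
already chosen. -/
theorem exists_of_forall_prev {ι : Type*} {β : Type*} {r : ι → ι → Prop} (hr : WellFounded r)
    (R : (i : ι) → ((j : ι) → r j i → β) → β → Prop) (hR : ∀ i prev, ∃ b, R i prev b) :
    ∃ g : ι → β, ∀ i, R i (fun j _ => g j) (g i) := by
  choose c hc using hR
  refine ⟨hr.fix c, fun i => ?_⟩
  rw [hr.fix_eq c i]
  exact hc i fun j _ => hr.fix c j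

section Construction

variable {P : PartialSemigroup S} {Q : PartialSemigroup T} {h : S → T} {A : Set T}
  {q : Ultrafilter S}

/-- `M` collects all `a ∗ ∏_{t ∈ H} f t` with `f ∈ F`, together with their left multiples by
the elements of `W`. -/
def CollectsProducts (P : PartialSemigroup S) (F : Finset {f : ℕ → S // P.AdequateSeq f})
    (W M : Finset S) (a : S) (H : Finset ℕ) : Prop :=
  ∀ f ∈ F, ∃ z ∈ M, (P.finProd f.1 H).bind (P.op a) = some z ∧
    ∀ w ∈ W, ∃ y ∈ M, P.op w z = some y

theorem exists_collectsProducts (hhom : IsPSHom P Q h) (hq : q ∈ P.Jdelta)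
    (hid : Q.IsIdempotent (q.map h)) (hA : A ∈ q.map h) (N : ℕ)
    (F : Finset {f : ℕ → S // P.AdequateSeq f}) (hF : F.Nonempty)
    (W : Finset S) (hW : ∀ w ∈ W, h w ∈ Q.star (q.map h) A) :
    ∃ (M : Finset S) (a : S) (H : Finset ℕ), (∀ z ∈ M, h z ∈ Q.star (q.map h) A) ∧
      H.Nonempty ∧ (∀ n ∈ H, N ≤ n) ∧ P.CollectsProducts F W M a H := by
  classical
  set B := Q.star (q.map h) A
  have hmem : h ⁻¹' (B ∩ ⋂ w ∈ W, Q.inv (h w) B) ∈ q := by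
    refine Ultrafilter.mem_map.1 (Filter.inter_mem (hid.star_mem hA) ?_)
    exact (Filter.biInter_finset_mem W).2 fun w hw => hid.inv_star_mem (hW w hw)
  obtain ⟨s⟩ : Nonempty S := q.nonempty_of_mem Filter.univ_mem |>.to_type
  obtain ⟨a, ha, H, hH, hN, hprod⟩ :=
    (hq.2 _ hmem).exists_beyond N F hF (insert s W) (Finset.insert_nonempty s W)
  have hstep : ∀ f : F, ∃ z, (P.finProd f.1.1 H).bind (P.op a) = some z ∧ h z ∈ B ∧
      ∀ w : W, ∃ y, P.op w z = some y ∧ h y ∈ B := by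
    rintro ⟨f, hf⟩
    obtain ⟨x, hx, hxW, z, hz, hzB, hzW⟩ := hprod f hf
    refine ⟨z, by simp [hx, hz], hzB, fun ⟨w, hw⟩ => ?_⟩
    obtain ⟨y, hy⟩ := exists_op_of_mem_sigma ha hxW hz (Finset.mem_insert_of_mem hw)
    obtain ⟨v, hv, hvB⟩ := Set.mem_iInter₂.1 hzW w hw
    rw [hhom _ _ _ hy, Option.some_inj] at hv
    exact ⟨y, hy, hv ▸ hvB⟩
  choose z hz hzB y hy hyB using hstep
  refine ⟨Finset.univ.image z ∪ Finset.univ.image fun i : F × W => y i.1 i.2, a, H, ?_, hH, hN,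
    fun f hf => ⟨z ⟨f, hf⟩, by simp, hz ⟨f, hf⟩, fun w hw => ⟨y ⟨f, hf⟩ ⟨w, hw⟩, ?_,
      hy ⟨f, hf⟩ ⟨w, hw⟩⟩⟩⟩
  · intro t ht
    simp only [Finset.mem_union, Finset.mem_image, Finset.mem_univ, true_and] at ht
    rcases ht with ⟨i, rfl⟩ | ⟨i, rfl⟩
    · exact hzB i
    · exact hyB i.1 i.2
  · exact Finset.mem_union_right _
      (Finset.mem_image.2 ⟨(⟨f, hf⟩, ⟨w, hw⟩), Finset.mem_univ _, rfl⟩)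

/-- If `q ∈ J_δ(S)` has an idempotent pushforward containing `A`, then `h ⁻¹' A` is a `C`-set. -/
theorem cSet_preimage_of_isIdempotent_map (hhom : IsPSHom P Q h) (hq : q ∈ P.Jdelta)
    (hid : Q.IsIdempotent (q.map h)) (hA : A ∈ q.map h) : P.CSet (h ⁻¹' A) := by
  classical
  let X := {f : ℕ → S // P.AdequateSeq f}
  let β := {M : Finset S // ∀ z ∈ M, h z ∈ Q.star (q.map h) A} × S × Finset ℕ
  let R : (F : Finset X) → ((G : Finset X) → G ⊂ F → β) → β → Prop := fun F prev b =>
    F.Nonempty → b.2.2.Nonempty ∧ P.CollectsProducts F ∅ b.1.1 b.2.1 b.2.2 ∧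
      ∀ G (hG : G ⊂ F), (∀ i ∈ (prev G hG).2.2, ∀ j ∈ b.2.2, i < j) ∧
        P.CollectsProducts F (prev G hG).1.1 b.1.1 b.2.1 b.2.2
  have hR : ∀ F prev, ∃ b, R F prev b := by
    intro F prev
    rcases F.eq_empty_or_nonempty with rfl | hF
    · obtain ⟨s⟩ : Nonempty S := q.nonempty_of_mem Filter.univ_mem |>.to_type
      exact ⟨⟨⟨∅, by simp⟩, s, ∅⟩, fun hF => absurd hF Finset.not_nonempty_empty⟩
    let prev' : F.ssubsets → β := fun G => prev G.1 (Finset.mem_ssubsets.1 G.2)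
    let W : Finset S := Finset.univ.biUnion fun G => (prev' G).1.1
    let K : Finset ℕ := Finset.univ.biUnion fun G => (prev' G).2.2
    have hW : ∀ w ∈ W, h w ∈ Q.star (q.map h) A := by
      intro w hw
      obtain ⟨G, -, hG⟩ := Finset.mem_biUnion.1 hw
      exact (prev' G).1.2 w hG
    obtain ⟨M, a, H, hM, hH, hN, hprod⟩ :=
      exists_collectsProducts hhom hq hid hA (K.sup id + 1) F hF W hW
    refine ⟨⟨⟨M, hM⟩, a, H⟩, fun _ => ⟨hH, fun f hf => ?_, fun G hG => ⟨fun i hi j hj => ?_,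
      fun f hf => ?_⟩⟩⟩
    · obtain ⟨z, hzM, hz, -⟩ := hprod f hf
      exact ⟨z, hzM, hz, by simp⟩
    · have hiK : i ∈ K :=
        Finset.mem_biUnion.2 ⟨⟨G, Finset.mem_ssubsets.2 hG⟩, Finset.mem_univ _, hi⟩
      exact (Nat.lt_succ_of_le (Finset.le_sup (f := id) hiK)).trans_le (hN j hj)
    · obtain ⟨z, hzM, hz, hzW⟩ := hprod f hf
      exact ⟨z, hzM, hz, fun w hw => hzW w
        (Finset.mem_biUnion.2 ⟨⟨G, Finset.mem_ssubsets.2 hG⟩, Finset.mem_univ _, hw⟩)⟩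
  obtain ⟨g, hg⟩ := exists_of_forall_prev (r := fun G F : Finset X => G ⊂ F) wellFounded_lt R hR
  refine ⟨fun F => (g F).2.1, fun F => (g F).2.2, fun F hF => (hg F hF).1,
    fun F G hF hFG => ((hg G (hF.mono hFG.1)).2.2 F hFG).1, fun m G hG hG0 f hf => ?_⟩
  suffices hlast : ∃ z ∈ (g (G (Fin.last m))).1.1, P.optListProd (List.ofFn fun i =>
      (P.finProd (f i).1 (g (G i)).2.2).bind (P.op (g (G i)).2.1)) = some z by
    obtain ⟨z, hzM, hz⟩ := hlast
    exact ⟨z, hz, ((g (G (Fin.last m))).1.2 z hzM).1⟩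
  induction m with
  | zero =>
    obtain ⟨z, hzM, hz, -⟩ := (hg (G 0) hG0).2.1 (f 0) (hf 0)
    exact ⟨z, hzM, by simpa [optListProd] using hz⟩
  | succ m ih =>
    obtain ⟨w, hwM, hw⟩ := ih (fun i => G i.castSucc)
      (fun i j hij => hG _ _ (Fin.castSucc_lt_castSucc_iff.2 hij)) hG0
      (fun i => f i.castSucc) (fun i => hf _)
    have hlt := hG (Fin.last m).castSucc (Fin.last (m + 1)) (Fin.castSucc_lt_last _)
    obtain ⟨z, hzM, hz, hzW⟩ := ((hg (G (Fin.last (m + 1)))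
      ⟨_, hf (Fin.last (m + 1))⟩).2.2 _ hlt).2 _ (hf (Fin.last (m + 1)))
    obtain ⟨y, hyM, hy⟩ := hzW w hwM
    refine ⟨y, hyM, ?_⟩
    rw [List.ofFn_succ', List.concat_eq_append, hz, optListProd_append_singleton P _ hw, hy]

end Construction

end PartialSemigroup

open PartialSemigroup

/-- If `h : S → T` is a surjective partial semigroup homomorphism
between commutative adequate partial semigroups, `q ∈ J_δ(S)`, and the pushforward
`p = h̃(q)` is an idempotent ultrafilter in `δT` with `A ∈ p`, then `h ⁻¹' A` is a
`C`-set in `S`. -/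
theorem stmt15 {S : Type u} {T : Type v}
    (P : PartialSemigroup S) (Q : PartialSemigroup T)
    (hS : P.Adequate) (hT : Q.Adequate) (hcS : P.Comm) (hcT : Q.Comm)
    (h : S → T) (hhom : IsPSHom P Q h) (hsurj : Function.Surjective h)
    (A : Set T) (q : Ultrafilter S) (hq : q ∈ P.Jdelta)
    (hpd : Ultrafilter.map h q ∈ Q.delta)
    (hid : Q.IsIdempotent (Ultrafilter.map h q))
    (hA : A ∈ Ultrafilter.map h q) :
    P.CSet (h ⁻¹' A) := by
  exact cSet_preimage_of_isIdempotent_map hhom hq hid hA
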